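/- Let k ≥ 2 be an even integer, let V be a real vector space with basis e₁, …, e_k and dual basis θ₁, …, θ_k, let κ₁, …, κ_k be real numbers with κ_ℓ ≥ 0 for all ℓ, and for i, j ∈ {1,…,k} let Ω_{ij} : V × V → ℝ be alternating bilinear maps with Ω_{ij} = −Ω_{ji}, satisfying: (a) for all indices i, j, p, q and all X₁, X₂, X₃, X₄ ∈ V, Σ_{ρ ∈ S₄} sgn(ρ) Ω_{ij}(X_{ρ(1)}, X_{ρ(2)}) Ω_{pq}(X_{ρ(3)}, X_{ρ(4)}) = 0; and (b) Ω_{ij}(e_i, e_j) ≤ 0 for all 1 ≤ i < j ≤ k. Define A_{ij}(X,Y) := Ω_{ij}(X,Y) + κ_i κ_j (θ_i(X) θ_j(Y) − θ_j(X) θ_i(Y)). Then Σ_{σ, τ ∈ S_k} sgn(σ) sgn(τ) ∏_{t=1}^{k/2} A_{σ(2t−1) σ(2t)}(e_{τ(2t−1)}, e_{τ(2t)}) ≤ 2^{k/2} · k! · ∏_{ℓ=1}^{k} κ_ℓ. -/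

import Mathlib

namespace PfAux

open Finset Equiv

variable {ι T : Type*} [Fintype ι] [DecidableEq ι] [Fintype T] [DecidableEq T]

/-- real sign of a permutation -/
noncomputable def sg {α : Type*} [Fintype α] [DecidableEq α] (σ : Perm α) : ℝ :=
  ((Perm.sign σ : ℤ) : ℝ)

lemma sg_mul {α : Type*} [Fintype α] [DecidableEq α] (σ τ : Perm α) :
    sg (σ * τ) = sg σ * sg τ := by
  simp [sg]

lemma sg_mul_self {α : Type*} [Fintype α] [DecidableEq α] (σ : Perm α) :
    sg σ * sg σ = 1 := by
  rcases Int.units_eq_one_or (Perm.sign σ) with h | h <;> simp [sg, h]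

lemma sum_perm_two (g : Perm (Fin 2) → ℝ) :
    ∑ ε : Perm (Fin 2), g ε = g 1 + g (swap 0 1) := by
  have : (univ : Finset (Perm (Fin 2))) = {1, swap 0 1} := by decide
  rw [this, sum_pair (by decide)]

lemma antisym (e : T × Fin 2 ≃ ι) (f : T → ι → ι → ℝ) :
    ∑ τ : Perm ι, sg τ * ∏ t, (f t (τ (e (t, 0))) (τ (e (t, 1)))
        - f t (τ (e (t, 1))) (τ (e (t, 0))))
      = 2 ^ Fintype.card T * ∑ τ : Perm ι, sg τ * ∏ t, f t (τ (e (t, 0))) (τ (e (t, 1))) := by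
  have h1 : ∀ τ : Perm ι, ∏ t, (f t (τ (e (t, 0))) (τ (e (t, 1)))
        - f t (τ (e (t, 1))) (τ (e (t, 0))))
      = ∑ ε : T → Perm (Fin 2), ∏ t, (sg (ε t) *
          f t (τ (e (t, ε t 0))) (τ (e (t, ε t 1)))) := by
    intro τ
    rw [← Fintype.prod_sum (fun t (ε : Perm (Fin 2)) =>
      sg ε * f t (τ (e (t, ε 0))) (τ (e (t, ε 1))))]
    refine prod_congr rfl fun t _ => ?_
    rw [sum_perm_two]
    simp [sg]
    ring
  simp_rw [h1, mul_sum]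
  rw [sum_comm]
  have h2 : ∀ ε : T → Perm (Fin 2), ∑ τ : Perm ι, sg τ * ∏ t, (sg (ε t) *
          f t (τ (e (t, ε t 0))) (τ (e (t, ε t 1)))) =
      ∑ τ : Perm ι, sg τ * ∏ t, f t (τ (e (t, 0))) (τ (e (t, 1))) := by
    intro ε
    rw [← Equiv.sum_comp (Equiv.mulRight (e.permCongr (Equiv.prodCongrRight ε)))
      (fun τ : Perm ι => sg τ * ∏ t, f t (τ (e (t, 0))) (τ (e (t, 1))))]
    refine sum_congr rfl fun τ _ => ?_
    have h3 : sg (e.permCongr (Equiv.prodCongrRight ε)) = ∏ t, sg (ε t) := by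
      simp [sg, Perm.sign_prodCongrRight]
    simp only [Equiv.coe_mulRight, sg_mul, h3, prod_mul_distrib]
    simp [mul_assoc]
  rw [sum_congr rfl fun ε _ => h2 ε, sum_const, card_univ, ← mul_sum]
  simp [Fintype.card_perm]

lemma wedge_zero (f : Fin 4 ↪ ι) (F : (Fin 4 → ι) → ℝ) (R : Perm ι → ℝ)
    (hF : ∀ X : Fin 4 → ι, ∑ ρ : Perm (Fin 4), sg ρ * F (X ∘ ρ) = 0)
    (hR : ∀ (τ : Perm ι) (ρ : Perm (Fin 4)), R (τ * ρ.viaFintypeEmbedding f) = R τ) :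
    ∑ τ : Perm ι, sg τ * (F (τ ∘ f) * R τ) = 0 := by
  have h2 : ∀ ρ : Perm (Fin 4), ∑ τ : Perm ι, sg τ * (F (τ ∘ f) * R τ) =
      ∑ τ : Perm ι, sg τ * R τ * (sg ρ * F ((τ ∘ f) ∘ ρ)) := by
    intro ρ
    rw [← Equiv.sum_comp (Equiv.mulRight (ρ.viaFintypeEmbedding f))]
    refine sum_congr rfl fun τ _ => ?_
    have h3 : sg (ρ.viaFintypeEmbedding f) = sg ρ := by
      simp [sg, Perm.viaFintypeEmbedding_sign]
    have h4 : (⇑(τ * ρ.viaFintypeEmbedding f) ∘ f) = (τ ∘ f) ∘ ρ := by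
      ext a; simp [Perm.viaFintypeEmbedding_apply_image]
    simp only [Equiv.coe_mulRight, sg_mul, h3, hR, h4]
    ring
  have h5 : ∑ ρ : Perm (Fin 4), ∑ τ : Perm ι, sg τ * (F (τ ∘ f) * R τ) = 0 := by
    rw [sum_congr rfl fun ρ _ => h2 ρ, sum_comm]
    refine sum_eq_zero fun τ _ => ?_
    rw [← mul_sum, hF, mul_zero]
  rw [sum_const, card_univ] at h5
  simpa [Fintype.card_perm, Nat.factorial] using h5

lemma two_zero (e : T × Fin 2 ≃ ι) (g h : T → ι → ι → ℝ)
    (hw : ∀ s t, ∀ X : Fin 4 → ι, ∑ ρ : Perm (Fin 4), sg ρ *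
      (g s (X (ρ 0)) (X (ρ 1)) * g t (X (ρ 2)) (X (ρ 3))) = 0)
    (S : Finset T) (s t : T) (hs : s ∈ S) (ht : t ∈ S) (hst : s ≠ t) :
    ∑ τ : Perm ι, sg τ * ((∏ r ∈ S, g r (τ (e (r, 0))) (τ (e (r, 1)))) *
      ∏ r ∈ univ \ S, h r (τ (e (r, 0))) (τ (e (r, 1)))) = 0 := by
  have hinj : Function.Injective ![e (s, 0), e (s, 1), e (t, 0), e (t, 1)] := by
    intro a c
    fin_cases a <;> fin_cases c <;> simp [hst, hst.symm]
  have key := wedge_zero ⟨_, hinj⟩ (fun X => g s (X 0) (X 1) * g t (X 2) (X 3))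
    (fun τ => (∏ r ∈ (S.erase s).erase t, g r (τ (e (r, 0))) (τ (e (r, 1)))) *
      ∏ r ∈ univ \ S, h r (τ (e (r, 0))) (τ (e (r, 1)))) (hw s t) ?_
  · rw [← key]
    refine sum_congr rfl fun τ _ => ?_
    rw [← mul_prod_erase S _ hs, ← mul_prod_erase (S.erase s) _ (mem_erase.2 ⟨hst.symm, ht⟩)]
    simp only [Function.comp, Function.Embedding.coeFn_mk, Matrix.cons_val]
    ring
  · intro τ ρ
    have h1 : ∀ r, r ≠ s → r ≠ t → ∀ c : Fin 2,
        (τ * ρ.viaFintypeEmbedding ⟨_, hinj⟩) (e (r, c)) = τ (e (r, c)) := by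
      intro r hrs hrt c
      rw [Perm.mul_apply, Perm.viaFintypeEmbedding_apply_notMem_range]
      rintro ⟨a, ha⟩
      fin_cases a <;> simp [hrs.symm, hrt.symm] at ha
    congr 1
    · refine prod_congr rfl fun r hr => ?_
      simp only [mem_erase] at hr
      rw [h1 r hr.2.1 hr.1, h1 r hr.2.1 hr.1]
    · refine prod_congr rfl fun r hr => ?_
      simp only [mem_sdiff, mem_univ, true_and] at hr
      have a1 : r ≠ s := fun h => hr (h ▸ hs)
      have a2 : r ≠ t := fun h => hr (h ▸ ht)
      rw [h1 r a1 a2, h1 r a1 a2]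

/-- Kronecker delta -/
noncomputable def dl (x y : ι) : ℝ := if x = y then 1 else 0

lemma zero_term (e : T × Fin 2 ≃ ι) (κ : ι → ℝ) (σ τ : Perm ι) :
    sg σ * sg τ * ∏ r, (κ (σ (e (r, 0))) * κ (σ (e (r, 1))) *
      (dl (σ (e (r, 0))) (τ (e (r, 0))) * dl (σ (e (r, 1))) (τ (e (r, 1)))))
      = if τ = σ then ∏ i, κ i else 0 := by
  split_ifs with h
  · subst h
    rw [sg_mul_self, one_mul, ← Equiv.prod_comp τ κ, ← Equiv.prod_comp e,
      Fintype.prod_prod_type]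
    simp [dl, Fin.prod_univ_two]
  · have : ∃ x, σ (e x) ≠ τ (e x) := by
      by_contra hc
      push Not at hc
      apply h
      ext y
      simpa using (hc (e.symm y)).symm
    obtain ⟨⟨r, c⟩, hx⟩ := this
    rw [prod_eq_zero (mem_univ r), mul_zero]
    fin_cases c
    · simp at hx; simp [dl, hx]
    · simp at hx; simp [dl, hx]

lemma one_term (e : T × Fin 2 ≃ ι) (κ : ι → ℝ) (hκ : ∀ i, 0 ≤ κ i)
    (W : ι → ι → ι → ι → ℝ) (hW : ∀ i j x y, W i j x y = - W i j y x)
    (hn : ∀ i j, i ≠ j → W i j i j ≤ 0) (s : T) (σ τ : Perm ι) :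
    sg σ * sg τ * (W (σ (e (s, 0))) (σ (e (s, 1))) (τ (e (s, 0))) (τ (e (s, 1))) *
      ∏ r ∈ univ \ {s}, (κ (σ (e (r, 0))) * κ (σ (e (r, 1))) *
      (dl (σ (e (r, 0))) (τ (e (r, 0))) * dl (σ (e (r, 1))) (τ (e (r, 1)))))) ≤ 0 := by
  have hp : 0 ≤ ∏ r ∈ univ \ {s}, (κ (σ (e (r, 0))) * κ (σ (e (r, 1))) *
      (dl (σ (e (r, 0))) (τ (e (r, 0))) * dl (σ (e (r, 1))) (τ (e (r, 1))))) := by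
    refine prod_nonneg fun r _ => ?_
    have : ∀ x y : ι, 0 ≤ dl x y := fun x y => by unfold dl; split_ifs <;> norm_num
    exact mul_nonneg (mul_nonneg (hκ _) (hκ _)) (mul_nonneg (this _ _) (this _ _))
  by_cases hall : ∀ r, r ≠ s → ∀ c : Fin 2, σ (e (r, c)) = τ (e (r, c))
  · have hne : e (s, 0) ≠ e (s, 1) := by simp
    have hnn := hn _ _ (σ.injective.ne hne)
    rw [← mul_assoc]
    refine mul_nonpos_of_nonpos_of_nonneg ?_ hp
    have hfix : ∀ y, y ≠ e (s, 0) → y ≠ e (s, 1) → σ y = τ y := by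
      intro y h0 h1
      obtain ⟨⟨r, c⟩, rfl⟩ := e.surjective y
      apply hall
      rintro rfl
      fin_cases c
      · exact h0 rfl
      · exact h1 rfl
    generalize e (s, 0) = p at *
    generalize e (s, 1) = q at *
    have hcases : τ = σ ∨ τ = σ * swap p q := by
      have hr : ∀ y, y = p ∨ y = q → σ⁻¹ (τ y) = p ∨ σ⁻¹ (τ y) = q := by
        intro y hy
        by_contra hc
        push Not at hc
        have := hfix _ hc.1 hc.2
        rw [show σ (σ⁻¹ (τ y)) = τ y from σ.apply_symm_apply _] at this
        have h2 := τ.injective this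
        rw [← h2] at hc
        rcases hy with h | h
        · exact hc.1 h
        · exact hc.2 h
      have e1 : ∀ y z, σ⁻¹ (τ y) = z → τ y = σ z := fun y z h => by rw [← h]; simp
      rcases hr p (Or.inl rfl) with h | h
      · left
        have hq : σ⁻¹ (τ q) = q := by
          rcases hr q (Or.inr rfl) with h' | h'
          · exact absurd (τ.injective ((σ⁻¹).injective (h.trans h'.symm))) hne
          · exact h'
        ext y
        by_cases hy : y = p
        · rw [hy, e1 _ _ h]
        by_cases hy' : y = q
        · rw [hy', e1 _ _ hq]
        rw [hfix y hy hy']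
      · right
        have hq : σ⁻¹ (τ q) = p := by
          rcases hr q (Or.inr rfl) with h' | h'
          · exact h'
          · exact absurd (τ.injective ((σ⁻¹).injective (h.trans h'.symm))) hne
        ext y
        by_cases hy : y = p
        · rw [hy, e1 _ _ h]; simp
        by_cases hy' : y = q
        · rw [hy', e1 _ _ hq]; simp
        rw [Perm.mul_apply, swap_apply_of_ne_of_ne hy hy', hfix y hy hy']
    rcases hcases with rfl | rfl
    · rw [sg_mul_self, one_mul]; exact hnn
    · have h1 : sg (swap p q) = -1 := by simp [sg, Perm.sign_swap hne]
      rw [sg_mul, ← mul_assoc, sg_mul_self, h1, hW]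
      simpa using hnn
  · push Not at hall
    obtain ⟨r, hrs, c, hx⟩ := hall
    have hm : r ∈ univ \ {s} := by simp [hrs]
    rw [prod_eq_zero hm, mul_zero, mul_zero]
    fin_cases c
    · simp at hx; simp [dl, hx]
    · simp at hx; simp [dl, hx]

lemma main (e : T × Fin 2 ≃ ι) (κ : ι → ℝ) (hκ : ∀ i, 0 ≤ κ i)
    (W : ι → ι → ι → ι → ℝ) (hW : ∀ i j x y, W i j x y = - W i j y x)
    (hn : ∀ i j, i ≠ j → W i j i j ≤ 0)
    (hw : ∀ i j p q, ∀ X : Fin 4 → ι, ∑ ρ : Perm (Fin 4), sg ρ *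
      (W i j (X (ρ 0)) (X (ρ 1)) * W p q (X (ρ 2)) (X (ρ 3))) = 0) :
    ∑ σ : Perm ι, ∑ τ : Perm ι, sg σ * sg τ * ∏ t,
      (W (σ (e (t, 0))) (σ (e (t, 1))) (τ (e (t, 0))) (τ (e (t, 1))) +
        κ (σ (e (t, 0))) * κ (σ (e (t, 1))) *
        (dl (σ (e (t, 0))) (τ (e (t, 0))) * dl (σ (e (t, 1))) (τ (e (t, 1))) -
          dl (σ (e (t, 1))) (τ (e (t, 0))) * dl (σ (e (t, 0))) (τ (e (t, 1))))) ≤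
    2 ^ Fintype.card T * (Nat.factorial (Fintype.card ι) : ℝ) * ∏ i, κ i := by
  -- step 1: antisymmetrization
  have s1 : ∀ σ : Perm ι, ∑ τ : Perm ι, sg σ * sg τ * ∏ t,
      (W (σ (e (t, 0))) (σ (e (t, 1))) (τ (e (t, 0))) (τ (e (t, 1))) +
        κ (σ (e (t, 0))) * κ (σ (e (t, 1))) *
        (dl (σ (e (t, 0))) (τ (e (t, 0))) * dl (σ (e (t, 1))) (τ (e (t, 1))) -
          dl (σ (e (t, 1))) (τ (e (t, 0))) * dl (σ (e (t, 0))) (τ (e (t, 1))))) =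
      2 ^ Fintype.card T * ∑ τ : Perm ι, sg σ * sg τ * ∏ t,
      ((1 / 2) * W (σ (e (t, 0))) (σ (e (t, 1))) (τ (e (t, 0))) (τ (e (t, 1))) +
        κ (σ (e (t, 0))) * κ (σ (e (t, 1))) *
        (dl (σ (e (t, 0))) (τ (e (t, 0))) * dl (σ (e (t, 1))) (τ (e (t, 1))))) := by
    intro σ
    have := antisym e (fun t x y => (1 / 2) * W (σ (e (t, 0))) (σ (e (t, 1))) x y +
        κ (σ (e (t, 0))) * κ (σ (e (t, 1))) * (dl (σ (e (t, 0))) x * dl (σ (e (t, 1))) y))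
    simp_rw [mul_assoc (sg σ), ← mul_sum]
    rw [mul_left_comm, ← this]
    congr 1
    refine sum_congr rfl fun τ _ => ?_
    congr 1
    refine prod_congr rfl fun t _ => ?_
    rw [hW _ _ (τ (e (t, 1))) (τ (e (t, 0)))]
    ring
  rw [sum_congr rfl fun σ _ => s1 σ, ← mul_sum, mul_assoc]
  refine mul_le_mul_of_nonneg_left ?_ (by positivity)
  have s2 : (Nat.factorial (Fintype.card ι) : ℝ) * ∏ i, κ i = ∑ σ : Perm ι, ∏ i, κ i := by
    rw [sum_const, card_univ, Fintype.card_perm, nsmul_eq_mul]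
  rw [s2]
  refine sum_le_sum fun σ _ => ?_
  simp_rw [prod_add, mul_sum]
  rw [sum_comm, powerset_univ, ← add_sum_erase _ _ (mem_univ ∅)]
  have s3 : ∑ τ : Perm ι, sg σ * sg τ * ((∏ t ∈ (∅ : Finset T),
      (1 / 2) * W (σ (e (t, 0))) (σ (e (t, 1))) (τ (e (t, 0))) (τ (e (t, 1)))) *
      ∏ t ∈ univ \ ∅, κ (σ (e (t, 0))) * κ (σ (e (t, 1))) *
        (dl (σ (e (t, 0))) (τ (e (t, 0))) * dl (σ (e (t, 1))) (τ (e (t, 1))))) =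
      ∏ i, κ i := by
    simp only [prod_empty, one_mul, sdiff_empty, zero_term e κ σ]
    simp
  rw [s3]
  suffices h : ∀ S ∈ (univ : Finset (Finset T)).erase ∅, ∑ τ : Perm ι, sg σ * sg τ * ((∏ t ∈ S,
      (1 / 2) * W (σ (e (t, 0))) (σ (e (t, 1))) (τ (e (t, 0))) (τ (e (t, 1)))) *
      ∏ t ∈ univ \ S, κ (σ (e (t, 0))) * κ (σ (e (t, 1))) *
        (dl (σ (e (t, 0))) (τ (e (t, 0))) * dl (σ (e (t, 1))) (τ (e (t, 1))))) ≤ 0 by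
    have := sum_nonpos h
    linarith
  intro S hS
  have hS' : S.Nonempty := nonempty_iff_ne_empty.2 (ne_of_mem_erase hS)
  obtain ⟨s, hs⟩ := hS'
  by_cases hone : S = {s}
  · subst hone
    refine sum_nonpos fun τ _ => ?_
    have := one_term e κ hκ W hW hn s σ τ
    rw [prod_singleton]
    linarith
  · have : ∃ t ∈ S, t ≠ s := by
      by_contra hc
      push Not at hc
      exact hone (eq_singleton_iff_unique_mem.2 ⟨hs, hc⟩)
    obtain ⟨t, ht, hts⟩ := this
    have := two_zero e (fun t x y => (1 / 2) * W (σ (e (t, 0))) (σ (e (t, 1))) x y)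
      (fun t x y => κ (σ (e (t, 0))) * κ (σ (e (t, 1))) *
        (dl (σ (e (t, 0))) x * dl (σ (e (t, 1))) y)) ?_ S s t hs ht hts.symm
    · simp_rw [mul_assoc (sg σ), ← mul_sum]
      rw [this, mul_zero]
    · intro s t X
      have h := hw (σ (e (s, 0))) (σ (e (s, 1))) (σ (e (t, 0))) (σ (e (t, 1))) X
      rw [← mul_zero (1 / 4 : ℝ), ← h, mul_sum]
      refine sum_congr rfl fun ρ _ => ?_
      ring

end PfAux


/-- Pointwise inequality `Pf_Γ ≤ GK`: if the ambient curvature 2-forms `Ω_{ij}` have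
vanishing pairwise wedge products and nonpositive diagonal components
`Ω_{ij}(e_i,e_j) ≤ 0`, and the principal curvatures `κ_ℓ` are nonnegative, then the
Pfaffian sum of `A_{ij} = Ω_{ij} + κ_i κ_j θ_i ∧ θ_j` on the basis is at most
`2^(k/2) k! ∏ κ_ℓ`. -/
theorem stmt_9 {V : Type*} [AddCommGroup V] [Module ℝ V]
    (k : ℕ) (hk : 2 ≤ k) (hke : Even k)
    (b : Module.Basis (Fin k) ℝ V) (κ : Fin k → ℝ) (hκ : ∀ ℓ, 0 ≤ κ ℓ)
    (Ω : Fin k → Fin k → V →ₗ[ℝ] V →ₗ[ℝ] ℝ)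
    (halt : ∀ (i j : Fin k) (X : V), Ω i j X X = 0)
    (hskew : ∀ i j : Fin k, Ω i j = - Ω j i)
    (hwedge : ∀ (i j p q : Fin k) (X : Fin 4 → V),
      ∑ ρ : Equiv.Perm (Fin 4), ((Equiv.Perm.sign ρ : ℤ) : ℝ) *
        (Ω i j (X (ρ 0)) (X (ρ 1)) * Ω p q (X (ρ 2)) (X (ρ 3))) = 0)
    (hneg : ∀ i j : Fin k, i < j → Ω i j (b i) (b j) ≤ 0) :
    ∑ σ : Equiv.Perm (Fin k), ∑ τ : Equiv.Perm (Fin k),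
      ((Equiv.Perm.sign σ : ℤ) : ℝ) * ((Equiv.Perm.sign τ : ℤ) : ℝ) *
        ∏ t : Fin (k / 2),
          (Ω (σ ⟨2 * t, by have := t.isLt; omega⟩)
              (σ ⟨2 * t + 1, by have := t.isLt; omega⟩)
              (b (τ ⟨2 * t, by have := t.isLt; omega⟩))
              (b (τ ⟨2 * t + 1, by have := t.isLt; omega⟩)) +
            κ (σ ⟨2 * t, by have := t.isLt; omega⟩) *
              κ (σ ⟨2 * t + 1, by have := t.isLt; omega⟩) *
              (b.coord (σ ⟨2 * t, by have := t.isLt; omega⟩)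
                  (b (τ ⟨2 * t, by have := t.isLt; omega⟩)) *
                b.coord (σ ⟨2 * t + 1, by have := t.isLt; omega⟩)
                  (b (τ ⟨2 * t + 1, by have := t.isLt; omega⟩)) -
                b.coord (σ ⟨2 * t + 1, by have := t.isLt; omega⟩)
                  (b (τ ⟨2 * t, by have := t.isLt; omega⟩)) *
                b.coord (σ ⟨2 * t, by have := t.isLt; omega⟩)
                  (b (τ ⟨2 * t + 1, by have := t.isLt; omega⟩)))) ≤
      2 ^ (k / 2) * (Nat.factorial k : ℝ) * ∏ ℓ : Fin k, κ ℓ := by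
  have hk2 : k / 2 * 2 = k := Nat.div_mul_cancel hke.two_dvd
  have e0 : ∀ t : Fin (k / 2), (finProdFinEquiv.trans (finCongr hk2)) (t, (0 : Fin 2)) =
      ⟨2 * t, by have := t.isLt; omega⟩ := by
    intro t; ext; simp
  have e1 : ∀ t : Fin (k / 2), (finProdFinEquiv.trans (finCongr hk2)) (t, (1 : Fin 2)) =
      ⟨2 * t + 1, by have := t.isLt; omega⟩ := by
    intro t; ext; simp; omega
  have hW : ∀ (i j : Fin k) (x y : V), Ω i j x y = - Ω i j y x := by
    intro i j x y
    have := halt i j (x + y)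
    simp [halt] at this
    linarith
  have hm := PfAux.main (finProdFinEquiv.trans (finCongr hk2)) κ hκ
    (fun i j x y => Ω i j (b x) (b y)) (fun i j x y => hW i j _ _) ?_
    (fun i j p q X => hwedge i j p q (fun a => b (X a)))
  · simp only [e0, e1, Fintype.card_fin] at hm
    refine le_trans (le_of_eq ?_) hm
    have hc : ∀ i x : Fin k, b.coord i (b x) = PfAux.dl i x := by
      intro i x
      simp [PfAux.dl, Finsupp.single_apply, eq_comm]
    simp only [hc]
    rfl
  · intro i j hij
    rcases lt_or_gt_of_ne hij with h | h
    · exact hneg i j h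
    · have h1 := hneg j i h
      have h2 : Ω i j (b i) (b j) = Ω j i (b j) (b i) := by
        rw [hskew i j, hW j i (b j)]; simp
      simpa [h2] using h1
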